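/- Let V be a Banach 𝕆-bimodule and T = ∑_{i=0}^{7} e_i ⊙ T_i a bounded right para-linear operator on V, where each T_i is a bounded octonionic linear operator on V. If T_i T_j = T_j T_i for all i, j ∈ {0, 1, …, 7}, then T is power-associative. -/

import Mathlib

noncomputable section

open scoped BigOperators

/-- Octonions, realized via the Cayley–Dickson doubling of the quaternions. -/
@[ext]
structure Oct : Type where
  a : Quaternion ℝ
  b : Quaternion ℝ

namespace Oct

instance : Zero Oct := ⟨⟨0, 0⟩⟩
instance : Add Oct := ⟨fun x y => ⟨x.a + y.a, x.b + y.b⟩⟩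
instance : Neg Oct := ⟨fun x => ⟨-x.a, -x.b⟩⟩
instance : Sub Oct := ⟨fun x y => ⟨x.a - y.a, x.b - y.b⟩⟩
instance : SMul ℕ Oct := ⟨fun n x => ⟨n • x.a, n • x.b⟩⟩
instance : SMul ℤ Oct := ⟨fun n x => ⟨n • x.a, n • x.b⟩⟩
instance : SMul ℝ Oct := ⟨fun r x => ⟨r • x.a, r • x.b⟩⟩

def toLp (x : Oct) : WithLp 2 (Quaternion ℝ × Quaternion ℝ) :=
  (WithLp.equiv 2 (Quaternion ℝ × Quaternion ℝ)).symm (x.a, x.b)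

lemma toLp_injective : Function.Injective toLp := by
  rintro ⟨xa, xb⟩ ⟨ya, yb⟩ h
  have ha : xa = ya :=
    congrArg (fun z => (WithLp.equiv 2 (Quaternion ℝ × Quaternion ℝ) z).1) h
  have hb : xb = yb :=
    congrArg (fun z => (WithLp.equiv 2 (Quaternion ℝ × Quaternion ℝ) z).2) h
  subst ha; subst hb; rfl

instance : AddCommGroup Oct :=
  toLp_injective.addCommGroup toLp rfl (fun _ _ => rfl) (fun _ => rfl) (fun _ _ => rfl)
    (fun _ _ => rfl) (fun _ _ => rfl)

def toLpHom : Oct →+ WithLp 2 (Quaternion ℝ × Quaternion ℝ) where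
  toFun := toLp
  map_zero' := rfl
  map_add' _ _ := rfl

instance : Module ℝ Oct := toLp_injective.module ℝ toLpHom fun _ _ => rfl

instance : NormedAddCommGroup Oct :=
  NormedAddCommGroup.induced Oct (WithLp 2 (Quaternion ℝ × Quaternion ℝ)) toLpHom toLp_injective

instance : NormedSpace ℝ Oct := ⟨fun r x => norm_smul_le r (toLp x)⟩

def toProdLin : Oct →ₗ[ℝ] Quaternion ℝ × Quaternion ℝ where
  toFun x := (x.a, x.b)
  map_add' _ _ := rfl
  map_smul' _ _ := rfl

lemma toProdLin_injective : Function.Injective toProdLin := by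
  rintro ⟨xa, xb⟩ ⟨ya, yb⟩ h
  have ha : xa = ya := congrArg Prod.fst h
  have hb : xb = yb := congrArg Prod.snd h
  subst ha; subst hb; rfl

instance : FiniteDimensional ℝ Oct :=
  FiniteDimensional.of_injective toProdLin toProdLin_injective

instance : CompleteSpace Oct := FiniteDimensional.complete ℝ Oct

instance : One Oct := ⟨⟨1, 0⟩⟩

instance : Mul Oct :=
  ⟨fun x y => ⟨x.a * y.a - star y.b * x.b, y.b * x.a + x.b * star y.a⟩⟩

/-- Octonionic conjugation. -/
def conj (x : Oct) : Oct := ⟨star x.a, -x.b⟩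

/-- The real part of an octonion. -/
def re (x : Oct) : ℝ := x.a.re

/-- Powers of an octonion (association chosen on the left factor). -/
def opow (s : Oct) : ℕ → Oct
  | 0 => 1
  | n + 1 => s * opow s n

/-- The inverse of a nonzero octonion. -/
def oinv (s : Oct) : Oct := (‖s‖ ^ 2)⁻¹ • conj s

/-- `invPow s n` is the octonion `s ^ (-1 - n)`. -/
def invPow (s : Oct) (n : ℕ) : Oct := opow (oinv s) (n + 1)

def eNat : ℕ → Oct
  | 0 => ⟨1, 0⟩
  | 1 => ⟨⟨0, 1, 0, 0⟩, 0⟩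
  | 2 => ⟨⟨0, 0, 1, 0⟩, 0⟩
  | 3 => ⟨⟨0, 0, 0, 1⟩, 0⟩
  | 4 => ⟨0, 1⟩
  | 5 => ⟨0, ⟨0, 1, 0, 0⟩⟩
  | 6 => ⟨0, ⟨0, 0, 1, 0⟩⟩
  | 7 => ⟨0, ⟨0, 0, 0, 1⟩⟩
  | _ => 0

/-- The standard basis `e_0 = 1, e_1, …, e_7` of the octonions. -/
def e (i : Fin 8) : Oct := eNat i.val

/-- The six-dimensional sphere `𝕊` of imaginary units of `𝕆`. -/
def unitSphere : Set Oct := {J | J * J = -1}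

/-- The slice `ℂ_J = ℝ ⊕ ℝJ` of the octonions. -/
def sliceC (J : Oct) : Set Oct := {s | ∃ x y : ℝ, s = x • (1 : Oct) + y • J}

/-- The embedding of `ℂ` onto the slice `ℂ_J`, `x + y i ↦ x + y J`. -/
def toSlice (J : Oct) (z : ℂ) : Oct := z.re • (1 : Oct) + z.im • J

end Oct

open Oct

/-- A (normed/Banach) `𝕆`-bimodule: a real normed space with continuous real-bilinear left and
right octonionic multiplications satisfying the alternativity relations
`[p,q,x] = [q,x,p] = [x,p,q] = -[q,p,x]` and the norm identities `‖px‖ = |p|‖x‖ = ‖xp‖`. -/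
class OctBimodule (V : Type*) [NormedAddCommGroup V] [NormedSpace ℝ V] : Type _ where
  lm : Oct →ₗ[ℝ] V →L[ℝ] V
  rm : Oct →ₗ[ℝ] V →L[ℝ] V
  lm_one : ∀ x : V, lm 1 x = x
  rm_one : ∀ x : V, rm 1 x = x
  /-- `[p,q,x] = [q,x,p]` -/
  assoc_cyc₁ : ∀ (p q : Oct) (x : V),
    lm (p * q) x - lm p (lm q x) = rm p (lm q x) - lm q (rm p x)
  /-- `[p,q,x] = [x,p,q]` -/
  assoc_cyc₂ : ∀ (p q : Oct) (x : V),
    lm (p * q) x - lm p (lm q x) = rm q (rm p x) - rm (p * q) x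
  /-- `[p,q,x] = -[q,p,x]` -/
  assoc_alt : ∀ (p q : Oct) (x : V),
    lm (p * q) x - lm p (lm q x) = -(lm (q * p) x - lm q (lm p x))
  norm_lm : ∀ (p : Oct) (x : V), ‖lm p x‖ = ‖p‖ * ‖x‖
  norm_rm : ∀ (p : Oct) (x : V), ‖rm p x‖ = ‖p‖ * ‖x‖

section OctMod

variable {V : Type*} [NormedAddCommGroup V] [NormedSpace ℝ V] [OctBimodule V]

/-- Left multiplication `x ↦ p x` as a bounded real-linear operator. -/
def lmo (p : Oct) : V →L[ℝ] V := OctBimodule.lm p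

/-- Right multiplication `R_p : x ↦ x p` as a bounded real-linear operator. -/
def rmo (p : Oct) : V →L[ℝ] V := OctBimodule.rm p

variable (V)

/-- The real-part projection `Re x = (5/12) x - (1/12) ∑_{i=1}^7 e_i x e_i` of an
`𝕆`-bimodule. -/
def reO : V →L[ℝ] V :=
  (5 / 12 : ℝ) • ContinuousLinearMap.id ℝ V -
    (1 / 12 : ℝ) • ∑ i : Fin 7, (rmo (e i.succ)).comp (lmo (e i.succ))

/-- The real part `Re V` of an `𝕆`-bimodule, i.e. the set of associative central elements. -/
def ReSet : Set V :=
  {m | (∀ p q : Oct, lmo (p * q) m = lmo p (lmo q m)) ∧ ∀ p : Oct, lmo p m = rmo p m}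

/-- The slice `ℂ_J(V) = Re V ⊕ J · Re V` of an `𝕆`-bimodule. -/
def CJV (J : Oct) : Set V :=
  {x | ∃ u ∈ ReSet V, ∃ w ∈ ReSet V, x = u + lmo J w}

/-- The slice projection `π_J(x) = Re x + J Re (J̄ x)`. -/
def piJ (J : Oct) : V →L[ℝ] V :=
  reO V + (lmo J).comp ((reO V).comp (lmo (Oct.conj J)))

variable {V}

/-- The second right associator `B_p(T, x) = T(x) p - T(x p)` of an operator. -/
def Bop (p : Oct) (T : V →L[ℝ] V) : V →L[ℝ] V := (rmo p).comp T - T.comp (rmo p)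

/-- A bounded real-linear operator is right (octonionic) para-linear if `Re B_p(T,x) = 0`. -/
def IsRightPara (T : V →L[ℝ] V) : Prop := ∀ (p : Oct) (x : V), reO V (Bop p T x) = 0

/-- The left octonionic scalar multiplication `(p ⊙ T)(x) = p T(x) + B_p(T,x)` on operators. -/
def odotL (p : Oct) (T : V →L[ℝ] V) : V →L[ℝ] V := (lmo p).comp T + Bop p T

/-- The right octonionic scalar multiplication `(T ⊙ p)(x) = T(p x) - B_p(T,x)` on operators. -/
def odotR (T : V →L[ℝ] V) (p : Oct) : V →L[ℝ] V := T.comp (lmo p) - Bop p T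

/-- The lifting map, `(lif F)(x) = ∑_i F(x ē_i) e_i`. -/
def lifO (F : V →L[ℝ] V) : V →L[ℝ] V :=
  ∑ i : Fin 8, (rmo (e i)).comp (F.comp (rmo (Oct.conj (e i))))

/-- The extension map, `(ext G)(∑ x_i e_i) = ∑ G(x_i) e_i`, where `x_i = Re (x ē_i)`. -/
def extO (G : V →L[ℝ] V) : V →L[ℝ] V :=
  ∑ i : Fin 8, (rmo (e i)).comp (G.comp ((reO V).comp (rmo (Oct.conj (e i)))))

/-- The left regular power `T^{n⊚} = lif (Re ∘ Tⁿ)`. -/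
def rpowL (T : V →L[ℝ] V) (n : ℕ) : V →L[ℝ] V := lifO ((reO V).comp (T ^ n))

/-- The right regular power `T^{⊚n} = ext (Tⁿ|_{Re V})`. -/
def rpowR (T : V →L[ℝ] V) (n : ℕ) : V →L[ℝ] V := extO (T ^ n)

/-- The regular composition `f ⊚ g = lif (Re ∘ f ∘ g)`. -/
def rcomp (f g : V →L[ℝ] V) : V →L[ℝ] V := lifO ((reO V).comp (f.comp g))

/-- The composition associator `[f,g,x]_⊚ = (f ⊚ g)(x) - f(g(x))`. -/
def compAssoc (f g : V →L[ℝ] V) (x : V) : V := rcomp f g x - f (g x)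

/-- The right regular inverse `T^{⊚-} = ext (T⁻¹|_{Re V})` of an invertible operator. -/
def rinvR (T : V →L[ℝ] V) : V →L[ℝ] V := extO (Ring.inverse T)

/-- The left regular inverse `T^{-⊚} = lif (Re ∘ T⁻¹)` of an invertible operator. -/
def rinvL (T : V →L[ℝ] V) : V →L[ℝ] V := lifO ((reO V).comp (Ring.inverse T))

/-- An operator is power-associative if all of its (composition) powers are right
para-linear. -/
def IsPowerAssoc (T : V →L[ℝ] V) : Prop := ∀ n : ℕ, IsRightPara (T ^ n)

/-- A bounded operator is octonionic linear if `T(xp) = T(x)p` for all `p`. -/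
def IsOctLinear (T : V →L[ℝ] V) : Prop := ∀ (p : Oct) (x : V), T (rmo p x) = rmo p (T x)

/-- `S` is `ℂ_J`-extendable power associative: `Sⁿ(v s) = Sⁿ(v) s` for `v ∈ Re V`,
`s ∈ ℂ_J`, `n ≥ 1`. -/
def CJExtPA (J : Oct) (S : V →L[ℝ] V) : Prop :=
  ∀ n : ℕ, 1 ≤ n → ∀ v ∈ ReSet V, ∀ s ∈ sliceC J, (S ^ n) (rmo s v) = rmo s ((S ^ n) v)

/-- `S` is `ℂ_J`-liftable power associative: `Re (Sⁿ(v s)) = Re (Sⁿ(v) s)` for all `v ∈ V`,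
`s ∈ ℂ_J`, `n ≥ 1`. -/
def CJLiftPA (J : Oct) (S : V →L[ℝ] V) : Prop :=
  ∀ n : ℕ, 1 ≤ n → ∀ (v : V), ∀ s ∈ sliceC J,
    reO V ((S ^ n) (rmo s v)) = reO V (rmo s ((S ^ n) v))

/-- The pull-back slice-resolvent set `ρ*_J(T)`. -/
def pbResSlice (T : V →L[ℝ] V) (J : Oct) : Set Oct :=
  {s | s ∈ sliceC J ∧ IsUnit ((rmo s : V →L[ℝ] V) - T) ∧
    CJExtPA J (Ring.inverse ((rmo s : V →L[ℝ] V) - T))}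

/-- The pull-back resolvent set `ρ*(T)`. -/
def pbRes (T : V →L[ℝ] V) : Set Oct := ⋃ J ∈ unitSphere, pbResSlice T J

/-- The pull-back spectrum `σ*(T) = 𝕆 ∖ ρ*(T)`. -/
def pbSpec (T : V →L[ℝ] V) : Set Oct := Set.univ \ pbRes T

/-- The push-forward slice-resolvent set `ρ_{*J}(T)`. -/
def pfResSlice (T : V →L[ℝ] V) (J : Oct) : Set Oct :=
  {s | s ∈ sliceC J ∧ IsUnit ((rmo s : V →L[ℝ] V) - T) ∧
    CJLiftPA J (Ring.inverse ((rmo s : V →L[ℝ] V) - T))}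

/-- The push-forward resolvent set `ρ_*(T)`. -/
def pfRes (T : V →L[ℝ] V) : Set Oct := ⋃ J ∈ unitSphere, pfResSlice T J

/-- The push-forward spectrum `σ_*(T) = 𝕆 ∖ ρ_*(T)`. -/
def pfSpec (T : V →L[ℝ] V) : Set Oct := Set.univ \ pfRes T

/-- The real-part projection of the `𝕆`-bimodule `𝓑_RO(V)` of bounded right para-linear
operators, given by `Re A = (5/12) A - (1/12) ∑_{i=1}^7 (e_i ⊙ A) ⊙ e_i`. -/
def reOpB (A : V →L[ℝ] V) : V →L[ℝ] V :=
  (5 / 12 : ℝ) • A - (1 / 12 : ℝ) • ∑ i : Fin 7, odotR (odotL (e i.succ) A) (e i.succ)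

end OctMod

/-- A set `U ⊆ 𝕆` is slice-open if `U ∩ ℂ_J` is open in `ℂ_J` for every `J ∈ 𝕊`. -/
def SliceOpen (U : Set Oct) : Prop :=
  ∀ J ∈ unitSphere, IsOpen (Oct.toSlice J ⁻¹' U)

/-- A parametrization of the boundary `∂(U ∩ ℂ_J)` by finitely many continuously
differentiable, positively oriented Jordan curves (positivity of the orientation is encoded
through the winding numbers). -/
structure SliceContour (J : Oct) (U : Set Oct) where
  n : ℕ
  γ : Fin n → ℝ → ℂ
  smooth : ∀ i, ContDiff ℝ 1 (γ i)
  closed : ∀ i, γ i 0 = γ i 1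
  jordan : ∀ i, Set.InjOn (γ i) (Set.Ico (0 : ℝ) 1)
  image_eq : (⋃ i, γ i '' Set.Icc (0 : ℝ) 1) = frontier (Oct.toSlice J ⁻¹' U)
  winding_inside : ∀ z : ℂ, Oct.toSlice J z ∈ U →
    (∑ i, ∫ t in (0 : ℝ)..1, deriv (γ i) t / (γ i t - z)) = 2 * (Real.pi : ℂ) * Complex.I
  winding_outside : ∀ z : ℂ, Oct.toSlice J z ∉ closure U →
    (∑ i, ∫ t in (0 : ℝ)..1, deriv (γ i) t / (γ i t - z)) = 0

/-- The integral `∫_{∂(U ∩ ℂ_J)} Φ(s, ds)` along a slice contour: the integrand gets the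
point of the curve and its derivative (both in the coordinates of the slice). -/
def contourSum {J : Oct} {U : Set Oct} (Γ : SliceContour J U) {E : Type*}
    [NormedAddCommGroup E] [NormedSpace ℝ E] (Φ : ℂ → ℂ → E) : E :=
  ∑ i, ∫ t in (0 : ℝ)..1, Φ (Γ.γ i t) (deriv (Γ.γ i) t)

/-- An axially symmetric slice domain (s-domain) in `𝕆`. -/
structure IsAdmissibleDomain (U : Set Oct) : Prop where
  isOpen : IsOpen U
  isConnected : IsConnected U
  real_nonempty : (U ∩ {s : Oct | ∃ r : ℝ, s = r • (1 : Oct)}).Nonempty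
  axially : ∀ (z : ℂ), ∀ I ∈ unitSphere, ∀ J ∈ unitSphere,
    Oct.toSlice I z ∈ U → Oct.toSlice J z ∈ U
  slice_conn : ∀ J ∈ unitSphere, IsConnected (Oct.toSlice J ⁻¹' U)

section Adm

variable {V : Type*} [NormedAddCommGroup V] [NormedSpace ℝ V] [OctBimodule V]

/-- A `T`-left-admissible domain: an axially symmetric s-domain containing the pull-back
spectrum `σ*(T)`.  (The regularity of its slice boundaries is witnessed by the slice
contours used in the integrals.) -/
def LeftAdmissible (T : V →L[ℝ] V) (U : Set Oct) : Prop :=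
  IsAdmissibleDomain U ∧ pbSpec T ⊆ U

/-- A `T`-right-admissible domain: an axially symmetric s-domain containing the push-forward
spectrum `σ_*(T)`. -/
def RightAdmissible (T : V →L[ℝ] V) (U : Set Oct) : Prop :=
  IsAdmissibleDomain U ∧ pfSpec T ⊆ U

end Adm

/-- The axially symmetric set `Ω_D ⊆ 𝕆` induced by a conjugation-invariant set `D ⊆ ℂ`. -/
def OmegaD (D : Set ℂ) : Set Oct := ⋃ J ∈ unitSphere, Oct.toSlice J '' D

/-- `F` is the stem of a slice preserving slice regular function on `Ω_D`: it is holomorphic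
on the open conjugation-invariant set `D` and intertwines complex conjugation. -/
structure IsStem (D : Set ℂ) (F : ℂ → ℂ) : Prop where
  isOpen : IsOpen D
  conj_mem : ∀ z ∈ D, (starRingEnd ℂ) z ∈ D
  holo : DifferentiableOn ℂ F D
  conj_comm : ∀ z ∈ D, F ((starRingEnd ℂ) z) = (starRingEnd ℂ) (F z)

section FC

variable {V : Type*} [NormedAddCommGroup V] [NormedSpace ℝ V] [OctBimodule V]

/-- The slice integral `(1/2π) ∫_{∂(U∩ℂ_J)} (R_s - T)^{⊚-} ⊙ (ds_J f(s))` defining the left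
slice regular functional calculus of a slice preserving function with stem `F`. -/
def leftFC (T : V →L[ℝ] V) (J : Oct) {U : Set Oct} (Γ : SliceContour J U)
    (F : ℂ → ℂ) : V →L[ℝ] V :=
  (2 * Real.pi)⁻¹ • contourSum Γ fun z dz =>
    odotR (rinvR ((rmo (Oct.toSlice J z) : V →L[ℝ] V) - T))
      ((-(Oct.toSlice J dz) * J) * Oct.toSlice J (F z))

/-- The slice integral `(1/2π) ∫_{∂(U∩ℂ_J)} (f(s) ds_J) ⊙ (R_s - T)^{-⊚}` defining the right
slice regular functional calculus of a slice preserving function with stem `F`. -/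
def rightFC (T : V →L[ℝ] V) (J : Oct) {U : Set Oct} (Γ : SliceContour J U)
    (F : ℂ → ℂ) : V →L[ℝ] V :=
  (2 * Real.pi)⁻¹ • contourSum Γ fun z dz =>
    odotL (Oct.toSlice J (F z) * (-(Oct.toSlice J dz) * J))
      (rinvL ((rmo (Oct.toSlice J z) : V →L[ℝ] V) - T))

end FC

/-- The family of stems of the components, relative to `J = ∑ c_i e_i`, of a function of the
form `f₀ + f₁ • J` with `f₀, f₁` slice preserving with stems `F₀, F₁`. -/
def stemFamily (c : Fin 8 → ℝ) (F₀ F₁ : ℂ → ℂ) : Fin 8 → ℂ → ℂ :=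
  fun i z => if i = 0 then F₀ z else (c i : ℂ) * F₁ z

namespace Oct

/-- Left multiplication by an octonion, as a real-linear map. -/
def lmulLin (q : Oct) : Oct →ₗ[ℝ] Oct where
  toFun x := q * x
  map_add' x y := by
    refine Oct.ext ?_ ?_
    · show q.a * (x.a + y.a) - star (x.b + y.b) * q.b =
        (q.a * x.a - star x.b * q.b) + (q.a * y.a - star y.b * q.b)
      rw [mul_add, star_add, add_mul]; abel
    · show (x.b + y.b) * q.a + q.b * star (x.a + y.a) =
        (x.b * q.a + q.b * star x.a) + (y.b * q.a + q.b * star y.a)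
      rw [add_mul, star_add, mul_add]; abel
  map_smul' r x := by
    refine Oct.ext ?_ ?_
    · show q.a * (r • x.a) - star (r • x.b) * q.b = r • (q.a * x.a - star x.b * q.b)
      rw [mul_smul_comm, Quaternion.star_smul, smul_mul_assoc, smul_sub]
    · show (r • x.b) * q.a + q.b * star (r • x.a) = r • (x.b * q.a + q.b * star x.a)
      rw [smul_mul_assoc, Quaternion.star_smul, mul_smul_comm, smul_add]

/-- Left multiplication `L_q : x ↦ q x` as a bounded real-linear operator on `𝕆`. -/
def Lq (q : Oct) : Oct →L[ℝ] Oct := (lmulLin q).toContinuousLinearMap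

/-- The two-sphere `[q] = {Re q + |Im q| J : J ∈ 𝕊}` associated with an octonion `q`. -/
def qSphere (q : Oct) : Set Oct :=
  {s | ∃ J ∈ unitSphere, s = Oct.re q • (1 : Oct) + ‖q - Oct.re q • (1 : Oct)‖ • J}

end Oct


namespace Oct

open scoped Quaternion

/-- The Euclidean inner product of octonions. -/
def dot (x y : Oct) : ℝ :=
  x.a.re * y.a.re + x.a.imI * y.a.imI + x.a.imJ * y.a.imJ + x.a.imK * y.a.imK +
    (x.b.re * y.b.re + x.b.imI * y.b.imI + x.b.imJ * y.b.imJ + x.b.imK * y.b.imK)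

lemma mul_a (x y : Oct) : (x * y).a = x.a * y.a - star y.b * x.b := rfl

lemma mul_b (x y : Oct) : (x * y).b = y.b * x.a + x.b * star y.a := rfl

lemma add_a (x y : Oct) : (x + y).a = x.a + y.a := rfl

lemma add_b (x y : Oct) : (x + y).b = x.b + y.b := rfl

lemma smul_a (r : ℝ) (x : Oct) : (r • x).a = r • x.a := rfl

lemma smul_b (r : ℝ) (x : Oct) : (r • x).b = r • x.b := rfl

lemma neg_a (x : Oct) : (-x).a = -x.a := rfl

lemma neg_b (x : Oct) : (-x).b = -x.b := rfl

lemma one_a : (1 : Oct).a = 1 := rfl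

lemma one_b : (1 : Oct).b = 0 := rfl

lemma mul_add_mul_of_re_eq_zero {x y : Oct} (hx : re x = 0) (hy : re y = 0) :
    x * y + y * x = (-2 * dot x y) • (1 : Oct) := by
  have hx' : x.a.re = 0 := hx
  have hy' : y.a.re = 0 := hy
  apply Oct.ext <;> ext <;>
    simp [mul_a, mul_b, add_a, add_b, neg_a, neg_b, smul_a, smul_b, one_a, one_b, dot, hx', hy'] <;>
    ring

lemma mul_mul_of_re_eq_zero {x : Oct} (hx : re x = 0) (y : Oct) :
    x * (x * y) = (-dot x x) • y := by
  have hx' : x.a.re = 0 := hx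
  apply Oct.ext <;> ext <;>
    simp [mul_a, mul_b, smul_a, smul_b, dot, hx'] <;> ring

lemma re_mul_of_re_eq_zero {x : Oct} (hx : re x = 0) (y : Oct) : re (x * y) = -dot x y := by
  have hx' : x.a.re = 0 := hx
  simp [re, mul_a, dot, hx']
  ring

lemma re_e_succ (i : Fin 7) : re (e i.succ) = 0 := by
  fin_cases i <;> rfl

lemma dot_e_succ (i j : Fin 7) : dot (e i.succ) (e j.succ) = if i = j then 1 else 0 := by
  fin_cases i <;> fin_cases j <;> simp [e, eNat, dot]

lemma e_succ_mul_add (i j : Fin 7) :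
    e i.succ * e j.succ + e j.succ * e i.succ = if i = j then (-2 : ℝ) • (1 : Oct) else 0 := by
  rw [mul_add_mul_of_re_eq_zero (re_e_succ i) (re_e_succ j), dot_e_succ]
  split_ifs <;> simp

lemma e_succ_mul_mul (i : Fin 7) (y : Oct) : e i.succ * (e i.succ * y) = -y := by
  rw [mul_mul_of_re_eq_zero (re_e_succ i), dot_e_succ, if_pos rfl, neg_one_smul]

/-- Each imaginary basis unit `p` lies in a quaternionic triple `p, a, p a` to which some
imaginary basis unit `j` is orthogonal. -/
lemma exists_quaternionic_triple (i : Fin 7) : ∃ a j : Fin 7, i ≠ a ∧ i ≠ j ∧ a ≠ j ∧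
    e j.succ * (e i.succ * e a.succ) + (e i.succ * e a.succ) * e j.succ = 0 := by
  suffices h : ∃ a j : Fin 7, i ≠ a ∧ i ≠ j ∧ a ≠ j ∧
      dot (e j.succ) (e i.succ * e a.succ) = 0 by
    obtain ⟨a, j, hia, hij, haj, h⟩ := h
    refine ⟨a, j, hia, hij, haj, ?_⟩
    have hre : re (e i.succ * e a.succ) = 0 := by
      rw [re_mul_of_re_eq_zero (re_e_succ i), dot_e_succ, if_neg hia, neg_zero]
    rw [mul_add_mul_of_re_eq_zero (re_e_succ j) hre, h, mul_zero, zero_smul]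
  refine ⟨![1, 0, 0, 0, 0, 1, 2] i, ![3, 3, 3, 1, 1, 0, 0] i, ?_⟩
  fin_cases i <;> refine ⟨by decide, by decide, by decide, ?_⟩ <;>
    simp [dot, mul_a, mul_b] <;> simp [e, eNat]

end Oct

section OctLinear

variable {V : Type*} [NormedAddCommGroup V] [NormedSpace ℝ V] [OctBimodule V]

lemma lmo_one : (lmo 1 : V →L[ℝ] V) = 1 :=
  ContinuousLinearMap.ext OctBimodule.lm_one

lemma rmo_one : (rmo 1 : V →L[ℝ] V) = 1 :=
  ContinuousLinearMap.ext OctBimodule.rm_one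

lemma lmo_mul_sub_eq (p q : Oct) :
    (lmo (p * q) - lmo p * lmo q : V →L[ℝ] V) = rmo q * rmo p - rmo (p * q) :=
  ContinuousLinearMap.ext (OctBimodule.assoc_cyc₂ p q)

lemma rmo_mul_lmo_sub (p q : Oct) :
    (rmo p * lmo q - lmo q * rmo p : V →L[ℝ] V) = rmo q * rmo p - rmo (p * q) :=
  ContinuousLinearMap.ext fun x =>
    (OctBimodule.assoc_cyc₁ p q x).symm.trans (OctBimodule.assoc_cyc₂ p q x)

lemma lmo_mul_add_lmo_mul (p q : Oct) :
    (lmo p * lmo q + lmo q * lmo p : V →L[ℝ] V) = lmo (p * q + q * p) := by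
  have h : (lmo (p * q) - lmo p * lmo q : V →L[ℝ] V) = -(lmo (q * p) - lmo q * lmo p) :=
    ContinuousLinearMap.ext (OctBimodule.assoc_alt p q)
  have hadd : (lmo (p * q + q * p) : V →L[ℝ] V) = lmo (p * q) + lmo (q * p) :=
    map_add OctBimodule.lm _ _
  rw [hadd]
  linear_combination (norm := abel) -h

lemma rmo_mul_add_rmo_mul (p q : Oct) :
    (rmo p * rmo q + rmo q * rmo p : V →L[ℝ] V) = rmo (p * q + q * p) := by
  have hadd : (rmo (p * q + q * p) : V →L[ℝ] V) = rmo (p * q) + rmo (q * p) :=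
    map_add OctBimodule.rm _ _
  have hl : (lmo (p * q + q * p) : V →L[ℝ] V) = lmo (p * q) + lmo (q * p) :=
    map_add OctBimodule.lm _ _
  have h := lmo_mul_add_lmo_mul (V := V) p q
  have h₁ := lmo_mul_sub_eq (V := V) p q
  have h₂ := lmo_mul_sub_eq (V := V) q p
  rw [hl] at h
  rw [hadd]
  linear_combination (norm := abel) -h - h₁ - h₂

lemma lmo_e_mul_add (i j : Fin 7) :
    (lmo (e i.succ) * lmo (e j.succ) + lmo (e j.succ) * lmo (e i.succ) : V →L[ℝ] V) =
      if i = j then (-2 : ℝ) • 1 else 0 := by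
  rw [lmo_mul_add_lmo_mul, e_succ_mul_add]
  split_ifs
  · rw [← lmo_one]; exact map_smul OctBimodule.lm _ _
  · exact map_zero OctBimodule.lm

lemma rmo_e_mul_add (i j : Fin 7) :
    (rmo (e i.succ) * rmo (e j.succ) + rmo (e j.succ) * rmo (e i.succ) : V →L[ℝ] V) =
      if i = j then (-2 : ℝ) • 1 else 0 := by
  rw [rmo_mul_add_rmo_mul, e_succ_mul_add]
  split_ifs
  · rw [← rmo_one]; exact map_smul OctBimodule.rm _ _
  · exact map_zero OctBimodule.rm

lemma lmo_e_mul_self (i : Fin 7) : (lmo (e i.succ) * lmo (e i.succ) : V →L[ℝ] V) = -1 := by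
  have h := lmo_e_mul_add (V := V) i i
  rw [if_pos rfl] at h
  linear_combination (norm := module) (1 / 2 : ℝ) • h

lemma rmo_e_mul_self (i : Fin 7) : (rmo (e i.succ) * rmo (e i.succ) : V →L[ℝ] V) = -1 := by
  have h := rmo_e_mul_add (V := V) i i
  rw [if_pos rfl] at h
  linear_combination (norm := module) (1 / 2 : ℝ) • h


lemma rmo_e_anticomm {i j : Fin 7} (h : i ≠ j) :
    (rmo (e i.succ) * rmo (e j.succ) : V →L[ℝ] V) = -(rmo (e j.succ) * rmo (e i.succ)) := by
  rw [eq_neg_iff_add_eq_zero, rmo_e_mul_add, if_neg h]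

/-- The associator operator `x ↦ [p, a, x]`, written through right multiplications, intertwines
left and right multiplication by an imaginary basis unit `p`. -/
lemma lmo_e_mul_associator (i : Fin 7) (a : Oct) :
    (lmo (e i.succ) * (rmo a * rmo (e i.succ) - rmo (e i.succ * a)) : V →L[ℝ] V) =
      (rmo a * rmo (e i.succ) - rmo (e i.succ * a)) * rmo (e i.succ) := by
  set p := e i.succ with hp
  have hA := lmo_mul_sub_eq (V := V) p a
  have hA' := lmo_mul_sub_eq (V := V) p (p * a)
  have hl : (lmo (-a) : V →L[ℝ] V) = -lmo a := map_neg OctBimodule.lm a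
  have hr : (rmo (-a) : V →L[ℝ] V) = -rmo a := map_neg OctBimodule.rm a
  rw [hp, e_succ_mul_mul, ← hp, hl, hr] at hA'
  calc (lmo p * (rmo a * rmo p - rmo (p * a)) : V →L[ℝ] V)
      = lmo p * lmo (p * a) - (lmo p * lmo p) * lmo a := by
        rw [← hA, mul_sub, mul_assoc]
    _ = lmo p * lmo (p * a) + lmo a := by
        rw [hp, lmo_e_mul_self, neg_one_mul, sub_neg_eq_add]
    _ = -(rmo (p * a) * rmo p) + rmo a * (rmo p * rmo p) := by
        rw [hp, rmo_e_mul_self, mul_neg_one, ← hp]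
        linear_combination (norm := abel) -hA'
    _ = _ := by rw [sub_mul, mul_assoc]; abel

lemma IsOctLinear.commute_rmo {T : V →L[ℝ] V} (hT : IsOctLinear T) (p : Oct) :
    Commute T (rmo p) :=
  ContinuousLinearMap.ext fun x => hT p x

/-- A right octonionic linear operator commutes with the left multiplications as well. -/
lemma IsOctLinear.commute_lmo_e_succ {T : V →L[ℝ] V} (hT : IsOctLinear T) (i : Fin 7) :
    Commute T (lmo (e i.succ)) := by
  have hR := hT.commute_rmo
  obtain ⟨a, j, hia, hij, haj, hj⟩ := exists_quaternionic_triple i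
  set A : V →L[ℝ] V :=
    rmo (e a.succ) * rmo (e i.succ) - rmo (e i.succ * e a.succ) with hA
  have hTA : Commute T A := ((hR _).mul_right (hR _)).sub_right (hR _)
  have hLA := lmo_e_mul_associator (V := V) i (e a.succ)
  rw [← hA] at hLA
  set D : V →L[ℝ] V := T * lmo (e i.succ) - lmo (e i.succ) * T with hD
  have hDA : D * A = 0 := by
    rw [hD, sub_mul, mul_assoc, hLA, mul_assoc, hTA.eq, ← mul_assoc (lmo _) A, hLA,
      (hTA.mul_right (hR _)).eq, sub_self]
  have hDR : Commute D (rmo (e j.succ)) := by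
    have h := rmo_mul_lmo_sub (V := V) (e j.succ) (e i.succ)
    have hc : Commute T (rmo (e j.succ) * lmo (e i.succ) - lmo (e i.succ) * rmo (e j.succ)) := by
      rw [h]
      exact ((hR _).mul_right (hR _)).sub_right (hR _)
    have h₁ := hc.eq
    have h₂ := (hR (e j.succ)).eq
    rw [Commute, SemiconjBy, hD]
    linear_combination (norm := noncomm_ring)
      -h₁ + h₂ * lmo (e i.succ) - lmo (e i.succ) * h₂
  have hsum : A * rmo (e j.succ) + rmo (e j.succ) * A =
      (2 : ℝ) • (rmo (e j.succ) * (rmo (e a.succ) * rmo (e i.succ))) := by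
    have h₁ : rmo (e a.succ) * rmo (e i.succ) * rmo (e j.succ) =
        (rmo (e j.succ) * (rmo (e a.succ) * rmo (e i.succ)) : V →L[ℝ] V) := by
      rw [mul_assoc, rmo_e_anticomm hij, mul_neg, ← mul_assoc, rmo_e_anticomm haj, neg_mul,
        neg_neg, mul_assoc]
    have h₂ := rmo_mul_add_rmo_mul (V := V) (e j.succ) (e i.succ * e a.succ)
    have h₀ : (rmo 0 : V →L[ℝ] V) = 0 := map_zero OctBimodule.rm
    rw [hj, h₀] at h₂
    rw [hA, sub_mul, mul_sub, h₁, two_smul]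
    linear_combination (norm := abel) -h₂
  have hzero : D * (rmo (e j.succ) * (rmo (e a.succ) * rmo (e i.succ))) = 0 := by
    have h : (2 : ℝ) • (D * (rmo (e j.succ) * (rmo (e a.succ) * rmo (e i.succ)))) = 0 := by
      rw [← mul_smul_comm, ← hsum, mul_add, ← mul_assoc, hDA, zero_mul, ← mul_assoc, hDR.eq,
        mul_assoc, hDA, mul_zero, add_zero]
    exact (smul_eq_zero.mp h).resolve_left two_ne_zero
  have hunit (k : Fin 7) : IsUnit (rmo (e k.succ) : V →L[ℝ] V) :=
    ⟨⟨rmo (e k.succ), -rmo (e k.succ), by rw [mul_neg, rmo_e_mul_self, neg_neg],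
      by rw [neg_mul, rmo_e_mul_self, neg_neg]⟩, rfl⟩
  exact sub_eq_zero.mp
    ((((hunit j).mul ((hunit a).mul (hunit i))).mul_left_eq_zero).mp hzero)

/-- The operators commuting with every right multiplication, with the left multiplications by
imaginary basis units, and with every member of the family `Ts`. -/
def multCentralizer (Ts : Fin 8 → V →L[ℝ] V) : Subalgebra ℝ (V →L[ℝ] V) :=
  Subalgebra.centralizer ℝ
    (Set.range rmo ∪ Set.range (fun i : Fin 7 => lmo (e i.succ)) ∪ Set.range Ts)

lemma mem_multCentralizer {Ts : Fin 8 → V →L[ℝ] V} {P : V →L[ℝ] V} :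
    P ∈ multCentralizer Ts ↔ (∀ p, Commute P (rmo p)) ∧
      (∀ i : Fin 7, Commute P (lmo (e i.succ))) ∧ ∀ i, Commute P (Ts i) := by
  simp only [multCentralizer, Subalgebra.mem_centralizer_iff, Set.mem_union, or_imp, forall_and,
    Set.forall_mem_range, and_assoc, commute_iff_eq, eq_comm]

/-- A linear combination of imaginary units with commuting coefficients squares to minus the sum
of the squares of the coefficients. -/
lemma sum_lmo_mul_sq {Ts : Fin 7 → V →L[ℝ] V}
    (hL : ∀ i j : Fin 7, Commute (Ts i) (lmo (e j.succ))) (hcomm : ∀ i j, Commute (Ts i) (Ts j)) :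
    (∑ i, lmo (e i.succ) * Ts i) * (∑ i, lmo (e i.succ) * Ts i) = -∑ i, Ts i * Ts i := by
  have hterm (i j : Fin 7) : (lmo (e i.succ) * Ts i) * (lmo (e j.succ) * Ts j) =
      lmo (e i.succ) * lmo (e j.succ) * (Ts i * Ts j) := by
    rw [mul_assoc, ← mul_assoc (Ts i), (hL i j).eq, mul_assoc, mul_assoc]
  have hsum : (∑ i, lmo (e i.succ) * Ts i) * (∑ i, lmo (e i.succ) * Ts i) =
      ∑ i, ∑ j, lmo (e i.succ) * lmo (e j.succ) * (Ts i * Ts j) := by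
    simp only [Finset.sum_mul_sum, hterm]
  have hsum' : (∑ i, lmo (e i.succ) * Ts i) * (∑ i, lmo (e i.succ) * Ts i) =
      ∑ i, ∑ j, lmo (e j.succ) * lmo (e i.succ) * (Ts i * Ts j) := by
    rw [hsum, Finset.sum_comm]
    exact Finset.sum_congr rfl fun i _ => Finset.sum_congr rfl fun j _ => by
      rw [(hcomm j i).eq]
  have htwo : (∑ i, lmo (e i.succ) * Ts i) * (∑ i, lmo (e i.succ) * Ts i) +
      (∑ i, lmo (e i.succ) * Ts i) * (∑ i, lmo (e i.succ) * Ts i) =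
      (-2 : ℝ) • ∑ i, Ts i * Ts i := by
    nth_rewrite 1 [hsum]
    rw [hsum']
    simp only [← Finset.sum_add_distrib, ← add_mul, lmo_e_mul_add, ite_mul, zero_mul,
      smul_mul_assoc, one_mul, Finset.sum_ite_eq, Finset.mem_univ, if_true, Finset.smul_sum]
  linear_combination (norm := module) (1 / 2 : ℝ) • htwo

lemma IsRightPara.mul_add {T P Q : V →L[ℝ] V} (hT : IsRightPara T)
    (hPr : ∀ p, Commute P (rmo p)) (hPl : ∀ i : Fin 7, Commute P (lmo (e i.succ)))
    (hQ : ∀ p, Commute Q (rmo p)) : IsRightPara (P * T + Q) := by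
  intro p x
  have hRe : Commute P (reO V) :=
    ((Commute.one_right P).smul_right _).sub_right
      ((Commute.sum_right _ _ _ fun i _ => (hPr _).mul_right (hPl i)).smul_right _)
  have hB : Bop p (P * T + Q) = P * Bop p T := by
    change rmo p * (P * T + Q) - (P * T + Q) * rmo p = P * (rmo p * T - T * rmo p)
    linear_combination (norm := noncomm_ring) -(hPr p).eq * T - (hQ p).eq
  have h : reO V * (P * Bop p T) = P * (reO V * Bop p T) := by
    rw [← mul_assoc, ← hRe.eq, mul_assoc]
  rw [hB]
  calc reO V ((P * Bop p T) x) = P (reO V (Bop p T x)) := DFunLike.congr_fun h x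
    _ = 0 := by rw [hT p x, map_zero]

end OctLinear

/-- Let `V` be a Banach `𝕆`-bimodule and `T = ∑_{i=0}^{7} e_i ⊙ T_i` a
bounded right para-linear operator on `V`, where each `T_i` is a bounded octonionic linear
operator.  If `T_i T_j = T_j T_i` for all `i, j`, then `T` is power-associative. -/
theorem statement_4 {V : Type*} [NormedAddCommGroup V] [NormedSpace ℝ V] [CompleteSpace V]
    [OctBimodule V] (Ts : Fin 8 → V →L[ℝ] V) (hlin : ∀ i, IsOctLinear (Ts i))
    (hcomm : ∀ i j, (Ts i).comp (Ts j) = (Ts j).comp (Ts i))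
    (T : V →L[ℝ] V) (hTdef : T = ∑ i : Fin 8, odotL (e i) (Ts i))
    (hT : IsRightPara T) :
    IsPowerAssoc T := by
  have hmem (i : Fin 8) : Ts i ∈ multCentralizer Ts :=
    mem_multCentralizer.mpr ⟨(hlin i).commute_rmo, (hlin i).commute_lmo_e_succ, hcomm i⟩
  have hodot (i : Fin 8) : odotL (e i) (Ts i) = lmo (e i) * Ts i := by
    have hB : Bop (e i) (Ts i) = 0 := sub_eq_zero.mpr ((hlin i).commute_rmo (e i)).eq.symm
    rw [odotL, hB, add_zero]
    rfl
  have hsum : T = Ts 0 + ∑ i : Fin 7, lmo (e i.succ) * Ts i.succ := by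
    have h₀ : (lmo (e 0) : V →L[ℝ] V) = 1 := lmo_one
    simp only [hTdef, hodot, Fin.sum_univ_succ (n := 7), h₀, one_mul]
  have hTcomm {P : V →L[ℝ] V} (hP : P ∈ multCentralizer Ts) : Commute P T := by
    obtain ⟨-, hl, ht⟩ := mem_multCentralizer.mp hP
    rw [hsum]
    exact (ht 0).add_right (Commute.sum_right _ _ _ fun i _ => (hl i).mul_right (ht i.succ))
  set N : V →L[ℝ] V := Ts 0 * Ts 0 + ∑ i : Fin 7, Ts i.succ * Ts i.succ with hN
  have hNmem : N ∈ multCentralizer Ts :=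
    add_mem (mul_mem (hmem 0) (hmem 0)) (sum_mem fun i _ => mul_mem (hmem i.succ) (hmem i.succ))
  have hsq : T * T = (Ts 0 + Ts 0) * T - N := by
    have h := sum_lmo_mul_sq (Ts := fun i : Fin 7 => Ts i.succ)
      (fun i j => (hlin i.succ).commute_lmo_e_succ j) (fun i j => hcomm i.succ j.succ)
    have hS : ∑ i : Fin 7, lmo (e i.succ) * Ts i.succ = T - Ts 0 := by
      rw [hsum, add_sub_cancel_left]
    rw [hS] at h
    have h₀ := (hTcomm (hmem 0)).eq
    linear_combination (norm := (rw [hN]; noncomm_ring)) h - h₀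
  have hpow (n : ℕ) : ∃ P ∈ multCentralizer Ts, ∃ Q ∈ multCentralizer Ts, T ^ n = P * T + Q := by
    induction n with
    | zero => exact ⟨0, zero_mem _, 1, one_mem _, by rw [pow_zero, zero_mul, zero_add]⟩
    | succ n ih =>
      obtain ⟨P, hP, Q, hQ, h⟩ := ih
      refine ⟨P * (Ts 0 + Ts 0) + Q, add_mem (mul_mem hP (add_mem (hmem 0) (hmem 0))) hQ,
        -(P * N), neg_mem (mul_mem hP hNmem), ?_⟩
      rw [pow_succ, h, add_mul, mul_assoc, hsq]
      noncomm_ring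
  intro n
  obtain ⟨P, hP, Q, hQ, h⟩ := hpow n
  obtain ⟨hPr, hPl, -⟩ := mem_multCentralizer.mp hP
  rw [h]
  exact hT.mul_add hPr hPl (mem_multCentralizer.mp hQ).1
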